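/- ∫₀^∞ cos(2π x/5)/(exp(2π√x) − 1) dx = (8 − 3√5)/16. -/

import Mathlib

open Real MeasureTheory

open Filter Topology in
lemma bnd_int : Integrable (fun x : ℝ => Real.exp (-|x|/2)) := by
  have hc : Continuous (fun x : ℝ => Real.exp (-|x|/2)) := by fun_prop
  refine (hc.locallyIntegrable).integrable_of_isBigO_atBot_atTop (g := fun x => Real.exp (x/2))
    (g' := fun x => Real.exp (-(1/2)*x)) ?_ ?_ ?_ ?_
  · apply Asymptotics.IsBigO.of_bound 1
    filter_upwards [eventually_le_atBot 0] with x hx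
    rw [abs_of_nonpos hx]; simp
  · refine ⟨Set.Iic 0, Iic_mem_atBot 0, ?_⟩
    have := (integrableOn_exp_mul_Iic (a := 1/2) (by norm_num) 0)
    simpa [div_eq_inv_mul] using this
  · apply Asymptotics.IsBigO.of_bound 1
    filter_upwards [eventually_ge_atTop 0] with x hx
    rw [abs_of_nonneg hx]; simp; linarith
  · refine ⟨Set.Ioi 0, Ioi_mem_atTop 0, ?_⟩
    exact integrableOn_exp_mul_Ioi (by norm_num) 0

open Filter Topology in
lemma bnd_top : Tendsto (fun x : ℝ => Real.exp (-|x|/2)) atTop (𝓝 0) := by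
  apply Real.tendsto_exp_atBot.comp
  have : Tendsto (fun x : ℝ => |x|/2) atTop atTop :=
    (tendsto_abs_atTop_atTop).atTop_div_const (by norm_num)
  simpa [neg_div] using this

open Filter Topology in
lemma line_int (H : ℂ → ℂ) (y C T0 : ℝ)
    (hd : ∀ w : ℂ, w.im = y → ContinuousAt H w)
    (hH : ∀ x : ℝ, T0 ≤ |x| → ‖H (x + y * Complex.I)‖ ≤ C * Real.exp (-|x|/2)) :
    Integrable (fun x : ℝ => H (x + y * Complex.I)) := by
  have hc : Continuous (fun x : ℝ => H (x + y * Complex.I)) := by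
    rw [continuous_iff_continuousAt]
    intro x
    have h1 := hd (x + y * Complex.I) (by simp)
    exact ContinuousAt.comp (f := fun x : ℝ => (x + y * Complex.I : ℂ)) h1 (by fun_prop)
  refine (hc.locallyIntegrable).integrable_of_isBigO_atBot_atTop (g := fun x => Real.exp (-|x|/2))
    (g' := fun x => Real.exp (-|x|/2)) ?_ (bnd_int.integrableAtFilter _) ?_
      (bnd_int.integrableAtFilter _)
  · apply Asymptotics.IsBigO.of_bound C
    filter_upwards [tendsto_abs_atBot_atTop.eventually_ge_atTop T0] with x hx
    simpa using hH x hx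
  · apply Asymptotics.IsBigO.of_bound C
    filter_upwards [tendsto_abs_atTop_atTop.eventually_ge_atTop T0] with x hx
    simpa using hH x hx

open Filter Topology in
lemma strip_shift (H : ℂ → ℂ) (y0 y1 C T0 : ℝ)
    (hd : ∀ w : ℂ, w.im ∈ Set.uIcc y0 y1 → DifferentiableAt ℂ H w)
    (hH : ∀ x y : ℝ, T0 ≤ |x| → y ∈ Set.uIcc y0 y1 →
      ‖H (x + y * Complex.I)‖ ≤ C * Real.exp (-|x|/2)) :
    ∫ x : ℝ, H (x + y0 * Complex.I) = ∫ x : ℝ, H (x + y1 * Complex.I) := by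
  have i0 := line_int H y0 C T0 (fun w hw => (hd w (by simp [hw])).continuousAt)
    (fun x hx => hH x y0 hx (by simp))
  have i1 := line_int H y1 C T0 (fun w hw => (hd w (by simp [hw])).continuousAt)
    (fun x hx => hH x y1 hx (by simp))
  have l0 := intervalIntegral_tendsto_integral i0 tendsto_neg_atTop_atBot tendsto_id
  have l1 := intervalIntegral_tendsto_integral i1 tendsto_neg_atTop_atBot tendsto_id
  have rect : ∀ T : ℝ, _ := fun T => 
    Complex.integral_boundary_rect_eq_zero_of_differentiableOn H (⟨-T, y0⟩ : ℂ) ⟨T, y1⟩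
      (fun w hw => (hd w hw.2).differentiableWithinAt)
  simp only [smul_eq_mul] at rect
  have v : ∀ (s : ℝ), |s| = 1 → Tendsto (fun T : ℝ => Complex.I * ∫ y in y0..y1, H (((s * T : ℝ) : ℂ) + y * Complex.I))
      atTop (𝓝 0) := by
    intro s hs
    rw [tendsto_zero_iff_norm_tendsto_zero]
    have hb : Tendsto (fun T : ℝ => C * Real.exp (-|T|/2) * |y1 - y0|) atTop (𝓝 0) := by
      simpa using (bnd_top.const_mul C).mul_const |y1 - y0|
    refine tendsto_of_tendsto_of_tendsto_of_le_of_le' tendsto_const_nhds hb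
      (Eventually.of_forall fun _ => norm_nonneg _) ?_
    filter_upwards [tendsto_abs_atTop_atTop.eventually_ge_atTop T0] with T hT
    rw [norm_mul, Complex.norm_I, one_mul]
    apply intervalIntegral.norm_integral_le_of_norm_le_const
    intro y hy
    have := hH (s * T) y (by rw [abs_mul, hs, one_mul]; exact hT) (Set.uIoc_subset_uIcc hy)
    rwa [abs_mul, hs, one_mul] at this
  have vp := v 1 (by simp)
  have vm := v (-1) (by simp)
  have tot := ((l0.sub l1).add vp).sub vm
  have : (fun T : ℝ => (0:ℂ)) = fun T => _ := funext fun T => (rect T).symm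
  have z : Tendsto (fun T : ℝ => (0:ℂ)) atTop (𝓝 0) := tendsto_const_nhds
  rw [this] at z
  have := tendsto_nhds_unique z (by simpa using tot)
  exact (sub_eq_zero.mp this.symm)

noncomputable def rr : ℝ := √2 / 2
noncomputable def om : ℂ := ⟨rr, rr⟩
noncomputable def den (w : ℂ) : ℂ := Complex.exp (2 * π * om * w) - 1

lemma rr_sq : rr ^ 2 = 1 / 2 := by
  unfold rr; rw [div_pow, Real.sq_sqrt (by norm_num)]; norm_num
lemma rr_pos : 0 < rr := by unfold rr; positivity
lemma rr_lt : rr < 1 := by nlinarith [rr_sq, rr_pos]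
lemma rr_gt : 1 / 2 < rr := by nlinarith [rr_sq, rr_pos]
lemma om_sq : om ^ 2 = Complex.I := by
  have := rr_sq
  apply Complex.ext <;> simp [om, sq] at * <;> linarith
lemma om_ne : om ≠ 0 := by
  intro h
  have := congrArg Complex.re h
  simp [om] at this
  exact rr_pos.ne' this

lemma den_ne (w : ℂ) (h : |w.im| ≤ rr / 2) (hw : w ≠ 0) : den w ≠ 0 := by
  intro h0
  rw [den, sub_eq_zero, Complex.exp_eq_one_iff] at h0
  obtain ⟨n, hn⟩ := h0
  rw [← om_sq] at hn
  have hpi : (π : ℂ) ≠ 0 := by exact_mod_cast Real.pi_ne_zero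
  have h1 : w = n * om := by
    have : (2 * π * om) * w = (2 * π * om) * (n * om) := by rw [hn]; ring
    exact mul_left_cancel₀ (by simp [hpi, om_ne]) this
  have h2 : w.im = n * rr := by rw [h1]; simp [om]
  rw [h2, abs_mul, abs_of_pos rr_pos] at h
  have h3 : |(n:ℝ)| ≤ 1/2 := by nlinarith [rr_pos]
  have h4 : n = 0 := by
    by_contra hne
    have := Int.one_le_abs hne
    have h5 : (1:ℝ) ≤ |(n:ℝ)| := by exact_mod_cast this
    linarith
  apply hw; rw [h1, h4]; simp

lemma exp_sub_one_big (v : ℂ) (h : 1 ≤ |v.re|) : 1 / 2 ≤ ‖Complex.exp v - 1‖ := by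
  have h1 := abs_norm_sub_norm_le (Complex.exp v) 1
  rw [Complex.norm_exp, norm_one] at h1
  refine le_trans ?_ h1
  rcases le_abs.mp h with h | h
  · have := Real.add_one_le_exp v.re
    rw [le_abs]; left; linarith
  · have h2 := Real.add_one_le_exp (-v.re)
    have h3 : Real.exp v.re * Real.exp (-v.re) = 1 := by rw [← Real.exp_add]; simp
    rw [le_abs]; right
    nlinarith [Real.exp_pos v.re]

lemma arg_re (x y : ℝ) : (2 * π * om * (x + y * Complex.I)).re = 2 * π * rr * (x - y) := by
  simp [om]; ring
lemma arg_im (x y : ℝ) : (2 * π * om * (x + y * Complex.I)).im = 2 * π * rr * (x + y) := by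
  simp [om]; ring

lemma den_big (x y : ℝ) (hx : 2 ≤ |x|) (hy : |y| ≤ 1) : 1 / 2 ≤ ‖den (x + y * Complex.I)‖ := by
  apply exp_sub_one_big
  rw [arg_re, abs_mul, abs_of_pos (by have := rr_pos; positivity)]
  have h1 : 1 ≤ |x - y| := by
    have := abs_sub_abs_le_abs_sub x y; linarith
  have h2 : 1 ≤ 2 * π * rr := by nlinarith [Real.pi_gt_three, rr_gt]
  nlinarith

lemma den_big' (x : ℝ) : 1 / 2 ≤ ‖den (x + ((-(rr/2) : ℝ) : ℂ) * Complex.I)‖ := by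
  by_cases h : 1 ≤ |(2 * π * om * (x + ((-(rr/2) : ℝ) : ℂ) * Complex.I)).re|
  · exact exp_sub_one_big _ h
  · push Not at h
    have h1 := arg_re x (-(rr/2))
    have h2 := arg_im x (-(rr/2))
    unfold den
    set v := (2 * π * om * (x + ((-(rr/2) : ℝ) : ℂ) * Complex.I))
    have h3 : v.im = v.re - π := by
      rw [h1, h2]; linear_combination (-2 * π) * rr_sq
    have h4 : (Complex.exp v - 1).re ≤ -1 := by
      rw [Complex.sub_re, Complex.exp_re, h3, Real.cos_sub_pi]
      have h5 : 0 ≤ Real.cos v.re := by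
        apply Real.cos_nonneg_of_neg_pi_div_two_le_of_le <;>
          linarith [abs_lt.mp h, (abs_lt.mp h).1, (abs_lt.mp h).2, Real.pi_gt_three]
      have := Real.exp_pos v.re
      simp; nlinarith
    have := Complex.abs_re_le_norm (Complex.exp v - 1)
    have := neg_le_abs (Complex.exp v - 1).re
    linarith

lemma num_bound (R : ℝ) (hR : 0 ≤ R) : ∃ K : ℝ, 0 ≤ K ∧ ∀ x y : ℝ, |y| ≤ 1 → ∀ c : ℂ, ‖c‖ ≤ R →
    (1 + ‖(x + y * Complex.I : ℂ)‖) *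
    ‖Complex.exp (-(2 * π / 5) * (x + y * Complex.I) ^ 2 + c * (x + y * Complex.I))‖ ≤
      K * Real.exp (-|x|/2) := by
  refine ⟨Real.exp (3 + R + (R + 2)^2), by positivity, ?_⟩
  intro x y hy c hc
  rw [Complex.norm_exp, ← Real.exp_add]
  have h0 : 1 + ‖(x + y * Complex.I : ℂ)‖ ≤ Real.exp ‖(x + y * Complex.I : ℂ)‖ := by
    linarith [Real.add_one_le_exp ‖(x + y * Complex.I : ℂ)‖]
  have h1 : ‖(x + y * Complex.I : ℂ)‖ ≤ |x| + 1 := by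
    refine (norm_add_le _ _).trans ?_
    simp [hy]
  refine (mul_le_mul_of_nonneg_right h0 (Real.exp_pos _).le).trans ?_
  rw [← Real.exp_add]
  apply Real.exp_le_exp.mpr
  rw [Complex.add_re]
  have h2 : (c * (x + y * Complex.I)).re ≤ R * (|x| + 1) := by
    refine (Complex.re_le_norm _).trans ?_
    rw [norm_mul]
    exact mul_le_mul hc h1 (norm_nonneg _) hR
  have h3 : (-(2 * π / 5 : ℂ) * (x + y * Complex.I) ^ 2).re = -(2 * π / 5) * (x^2 - y^2) := by
    have : (-(2 * π / 5 : ℂ) * (x + y * Complex.I) ^ 2) = 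
      ((-(2 * π / 5) * (x^2 - y^2) : ℝ) : ℂ) + ((-(2 * π / 5) * (2 * x * y) : ℝ) : ℂ) * Complex.I := by
      push_cast
      linear_combination (-(2 * π / 5 : ℂ)) * y^2 * Complex.I_sq
    rw [this, Complex.add_re, Complex.ofReal_re, Complex.re_ofReal_mul]; simp
  rw [h3]
  have h4 : y ^ 2 ≤ 1 := by rw [← sq_abs]; nlinarith [abs_nonneg y]
  have h5 : 1 ≤ 2 * π / 5 := by linarith [Real.pi_gt_three]
  have h6 : 2 * π / 5 ≤ 2 := by linarith [Real.pi_lt_four]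
  have h7 : x ^ 2 = |x| ^ 2 := (sq_abs x).symm
  have h8 : -(2 * π / 5) * (x^2 - y^2) ≤ - |x|^2 + 2 := by
    rw [h7]; nlinarith [sq_nonneg |x|, sq_nonneg y]
  nlinarith [sq_nonneg (|x| - (R + 2)), abs_nonneg x]

lemma den_diff : Differentiable ℂ den := by
  unfold den; fun_prop

lemma den_zero : den 0 = 0 := by simp [den]

lemma shift_gen (X : ℂ → ℂ) (hX : Differentiable ℂ X) (h0 : X 0 = 0) (K : ℝ)
    (hK : ∀ x y : ℝ, |y| ≤ 1 → ‖X (x + y * Complex.I)‖ ≤ K * Real.exp (-|x|/2))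
    (y0 y1 : ℝ) (hy0 : |y0| ≤ rr / 2) (hy1 : |y1| ≤ rr / 2) :
    ∫ x : ℝ, X (x + y0 * Complex.I) / den (x + y0 * Complex.I) =
      ∫ x : ℝ, X (x + y1 * Complex.I) / den (x + y1 * Complex.I) ∧
    Integrable (fun x : ℝ => X (x + y1 * Complex.I) / den (x + y1 * Complex.I)) := by
  set H : ℂ → ℂ := fun w => dslope X 0 w / dslope den 0 w with hH
  have eqH : ∀ w : ℂ, w ≠ 0 → H w = X w / den w := by
    intro w hw
    simp only [hH, dslope_of_ne _ hw, slope_def_field, h0, den_zero, sub_zero]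
    rw [div_div_div_cancel_right₀ hw]
  have ae0 : ∀ y : ℝ, (fun x : ℝ => X (x + y * Complex.I) / den (x + y * Complex.I)) =ᵐ[volume] 
      fun x : ℝ => H (x + y * Complex.I) := by
    intro y
    have : ∀ᵐ x : ℝ, x ≠ 0 := by simp [ae_iff, measure_singleton]
    filter_upwards [this] with x hx
    rw [eqH]
    intro h
    have := congrArg Complex.re h
    simp at this
    exact hx this
  have ae : ∀ y : ℝ, ∫ x : ℝ, X (x + y * Complex.I) / den (x + y * Complex.I) = 
      ∫ x : ℝ, H (x + y * Complex.I) := fun y => integral_congr_ae (ae0 y)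
  have strip : ∀ y ∈ Set.uIcc y0 y1, |y| ≤ rr / 2 := by
    intro y hy
    rw [abs_le] at *
    rcases Set.mem_uIcc.mp hy with h | h <;> constructor <;> linarith
  rw [ae, ae, integrable_congr (ae0 y1)]
  have c1 : ∀ w : ℂ, w.im ∈ Set.uIcc y0 y1 → DifferentiableAt ℂ H w := by
    intro w hw
    have hw' := strip _ hw
    have d1 : Differentiable ℂ (dslope X 0) := by
      rw [← differentiableOn_univ, Complex.differentiableOn_dslope Filter.univ_mem]
      exact hX.differentiableOn
    have d2 : Differentiable ℂ (dslope den 0) := by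
      rw [← differentiableOn_univ, Complex.differentiableOn_dslope Filter.univ_mem]
      exact den_diff.differentiableOn
    refine (d1 w).div (d2 w) ?_
    by_cases h : w = 0
    · subst h
      rw [dslope_same]
      have : HasDerivAt den (Complex.exp (2 * π * om * 0) * (2 * π * om)) 0 := by
        have := (((hasDerivAt_id (0:ℂ)).const_mul (2 * π * om)).cexp).sub_const 1
        simp only [mul_one, id] at this
        exact this
      rw [this.deriv]
      have hpi : (π : ℂ) ≠ 0 := by exact_mod_cast Real.pi_ne_zero
      simp [hpi, om_ne]
    · rw [dslope_of_ne _ h, slope_def_field, den_zero]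
      simpa using ⟨den_ne w hw' h, h⟩
  have c2 : ∀ x y : ℝ, 2 ≤ |x| → y ∈ Set.uIcc y0 y1 →
      ‖H (x + y * Complex.I)‖ ≤ (2 * K) * Real.exp (-|x|/2) := by
    intro x y hx hy
    have hy' := strip y hy
    have hy1 : |y| ≤ 1 := by linarith [rr_lt]
    rw [eqH]
    · rw [norm_div, div_le_iff₀ (by linarith [den_big x y hx hy1])]
      have h1 := hK x y hy1
      have h2 := den_big x y hx hy1
      have h3 := (norm_nonneg _).trans h1
      nlinarith
    · intro h
      have := congrArg Complex.re h
      simp at this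
      rw [this] at hx; norm_num at hx
  exact ⟨strip_shift H y0 y1 (2 * K) 2 c1 c2, line_int H y1 (2 * K) 2
    (fun w hw => (c1 w (by simp [hw])).continuousAt) (fun x hx => c2 x y1 hx (by simp))⟩


noncomputable def nu (z w : ℂ) : ℂ :=
  Complex.exp (-(2 * π / 5) * w ^ 2 + (2 * π * z * om) * w)

noncomputable def MM (y : ℝ) (z : ℂ) : ℂ :=
  ∫ x : ℝ, om * nu z (x + y * Complex.I) / den (x + y * Complex.I)

noncomputable def M (z : ℂ) : ℂ := MM (-(rr/2)) z

lemma nu_diff (z : ℂ) : Differentiable ℂ (nu z) := by unfold nu; fun_prop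

lemma nu_bound (R : ℝ) (hR : 0 ≤ R) : ∃ K : ℝ, 0 ≤ K ∧ ∀ x y : ℝ, |y| ≤ 1 → ∀ z : ℂ, ‖z‖ ≤ R →
    (1 + ‖(x + y * Complex.I : ℂ)‖) * ‖nu z (x + y * Complex.I)‖ ≤ K * Real.exp (-|x|/2) := by
  obtain ⟨K, hK, h⟩ := num_bound (‖(2 * π : ℂ)‖ * R * ‖om‖) (by positivity)
  refine ⟨K, hK, fun x y hy z hz => h x y hy _ ?_⟩
  rw [norm_mul, norm_mul]
  gcongr

lemma nu_bound' (z : ℂ) : ∃ K : ℝ, 0 ≤ K ∧ ∀ x y : ℝ, |y| ≤ 1 → 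
    ‖nu z (x + y * Complex.I)‖ ≤ K * Real.exp (-|x|/2) := by
  obtain ⟨K, hK, h⟩ := nu_bound ‖z‖ (norm_nonneg _)
  refine ⟨K, hK, fun x y hy => le_trans ?_ (h x y hy z le_rfl)⟩
  nlinarith [norm_nonneg (x + y * Complex.I : ℂ), norm_nonneg (nu z (x + y * Complex.I))]

lemma MM_int (y : ℝ) (hy : |y| = rr / 2) (z : ℂ) :
    Integrable (fun x : ℝ => om * nu z (x + y * Complex.I) / den (x + y * Complex.I)) := by
  obtain ⟨K, hK, h⟩ := nu_bound' z
  refine line_int (fun w => om * nu z w / den w) y (2 * ‖om‖ * K) 2 ?_ ?_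
  · intro w hw
    refine ContinuousAt.div ?_ den_diff.continuous.continuousAt (den_ne w (by rw [hw, hy]) ?_)
    · exact continuousAt_const.mul (nu_diff z).continuous.continuousAt
    · rintro rfl
      rw [← hw] at hy
      simp at hy
      linarith [rr_pos]
  · intro x hx
    have hy1 : |y| ≤ 1 := by linarith [rr_lt]
    have h2 := den_big x y hx hy1
    have h1 := h x y hy1
    rw [norm_div, div_le_iff₀ (by linarith), norm_mul]
    have h3 := (norm_nonneg _).trans h1
    have h4 := mul_le_mul_of_nonneg_left h1 (norm_nonneg om)
    have h5 : 0 ≤ ‖om‖ * (K * Real.exp (-|x|/2)) := by positivity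
    nlinarith

lemma abs_m : |(-(rr/2))| = rr/2 := by rw [abs_neg, abs_of_pos]; linarith [rr_pos]
lemma abs_p : |(rr/2)| = rr/2 := by rw [abs_of_pos]; linarith [rr_pos]

lemma jump (z : ℂ) : M z - MM (rr/2) z = M 0 - MM (rr/2) 0 := by
  obtain ⟨K, hK, h⟩ := nu_bound' z
  obtain ⟨K', hK', h'⟩ := nu_bound' 0
  have := (shift_gen (fun w => om * nu z w - om * nu 0 w)
    (((nu_diff z).const_mul om).sub ((nu_diff 0).const_mul om)) (by simp [nu])
    (‖om‖ * K + ‖om‖ * K') (by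
      intro x y hy
      refine (norm_sub_le _ _).trans ?_
      rw [norm_mul, norm_mul]
      have h4 := mul_le_mul_of_nonneg_left (h x y hy) (norm_nonneg om)
      have h5 := mul_le_mul_of_nonneg_left (h' x y hy) (norm_nonneg om)
      linarith) (-(rr/2)) (rr/2) abs_m.le abs_p.le).1
  simp only [sub_div] at this
  rw [integral_sub (MM_int _ abs_m z) (MM_int _ abs_m 0),
    integral_sub (MM_int _ abs_p z) (MM_int _ abs_p 0)] at this
  unfold M MM
  linear_combination this

lemma om_eq : om = ((rr : ℝ) : ℂ) + ((rr : ℝ) : ℂ) * Complex.I := by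
  apply Complex.ext <;> simp [om]

lemma nu_shift (z w : ℂ) : nu z (w + om) = 
    Complex.exp (2 * π * Complex.I * (z - 1/5)) * nu (z - 2/5) w := by
  unfold nu
  rw [← Complex.exp_add]
  congr 1
  linear_combination (2 * π * z - 2 * π / 5) * om_sq

lemma den_shift (w : ℂ) : den (w + om) = den w := by
  unfold den
  rw [show 2 * (π:ℂ) * om * (w + om) = 2 * π * om * w + 2 * π * Complex.I by
    linear_combination (2 * π) * om_sq, Complex.exp_periodic]

lemma upper (z : ℂ) : MM (rr/2) z = Complex.exp (2 * π * Complex.I * (z - 1/5)) * M (z - 2/5) := by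
  unfold M MM
  rw [← integral_add_right_eq_self _ rr, ← integral_const_mul]
  congr 1
  ext x
  rw [show (((x + rr : ℝ) : ℂ) + ((rr/2 : ℝ) : ℂ) * Complex.I) =
    (x + ((-(rr/2) : ℝ) : ℂ) * Complex.I) + om by rw [om_eq]; push_cast; ring, nu_shift, den_shift]
  ring

lemma func2 (z : ℂ) : M z = (M 0 - MM (rr/2) 0) +
    Complex.exp (2 * π * Complex.I * (z - 1/5)) * M (z - 2/5) := by
  rw [← jump z, ← upper]; ring

lemma nu_step (z w : ℂ) : nu (z + 1) w - nu z w = nu z w * den w := by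
  unfold nu den
  rw [mul_sub, ← Complex.exp_add]
  ring_nf

lemma func1 (z : ℂ) : M (z + 1) - M z = om * (√(5/2) : ℝ) * Complex.exp (5 * π * Complex.I / 2 * z ^ 2) := by
  have hpi : (π : ℂ) ≠ 0 := by exact_mod_cast Real.pi_ne_zero
  unfold M MM
  rw [← integral_sub (MM_int _ abs_m _) (MM_int _ abs_m _)]
  have : ∀ x : ℝ, om * nu (z + 1) (x + ((-(rr/2) : ℝ) : ℂ) * Complex.I) / den (x + ((-(rr/2) : ℝ) : ℂ) * Complex.I)
     - om * nu z (x + ((-(rr/2) : ℝ) : ℂ) * Complex.I) / den (x + ((-(rr/2) : ℝ) : ℂ) * Complex.I) =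
     om * Complex.exp (((-(2 * π / 5) : ℝ) : ℂ) * x ^ 2 + (2 * π / 5 * rr * Complex.I + 2 * π * z * om) * x
        + (2 * π / 5 * rr ^ 2 / 4 - 2 * π * z * om * (rr / 2) * Complex.I)) := by
    intro x
    have hne : den (x + ((-(rr/2) : ℝ) : ℂ) * Complex.I) ≠ 0 := by
      have := den_big' x
      intro h; rw [h] at this; norm_num at this
    rw [← sub_div, ← mul_sub, nu_step, mul_div_assoc, mul_div_cancel_right₀ _ hne]
    unfold nu
    congr 2
    push_cast
    linear_combination (-(2 * π / 5 : ℂ)) * (rr ^ 2 / 4) * Complex.I_sq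
  simp_rw [this]
  rw [integral_const_mul, integral_cexp_quadratic (by simp; positivity), ← mul_assoc]
  congr 1
  congr 1
  · rw [show (π : ℂ) / -((-(2 * π / 5) : ℝ) : ℂ) = ((5 / 2 : ℝ) : ℂ) by push_cast; field_simp]
    rw [Real.sqrt_eq_rpow, Complex.ofReal_cpow (by norm_num)]
    norm_num
  · congr 1
    have e : (2 * π / 5 * rr * Complex.I + 2 * π * z * om) ^ 2 / (4 * ((-(2 * π / 5) : ℝ) : ℂ)) =
        -(5 * π / 2) * (rr * Complex.I / 5 + z * om) ^ 2 := by
      push_cast; field_simp; ring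
    rw [e]
    linear_combination (5 * π / 2 * (rr ^ 2 / 25)) * Complex.I_sq + (5 * π / 2 * z ^ 2) * om_sq

lemma M_deriv (z : ℂ) : HasDerivAt M (∫ x : ℝ, om * (2 * π * om * (x + ((-(rr/2) : ℝ) : ℂ) * Complex.I)) *
    nu z (x + ((-(rr/2) : ℝ) : ℂ) * Complex.I) / den (x + ((-(rr/2) : ℝ) : ℂ) * Complex.I)) z := by
  obtain ⟨K, hK, h⟩ := nu_bound (‖z‖ + 1) (by positivity)
  have hcont : Continuous fun x : ℝ => (x + ((-(rr/2) : ℝ) : ℂ) * Complex.I) := by fun_prop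
  have hne : ∀ x : ℝ, den (x + ((-(rr/2) : ℝ) : ℂ) * Complex.I) ≠ 0 := by
      intro x
      have := den_big' x
      intro h; rw [h] at this; norm_num at this
  refine (hasDerivAt_integral_of_dominated_loc_of_deriv_le (s := Metric.ball z 1)
    (F := fun z (x:ℝ) => om * nu z (x + ((-(rr/2) : ℝ) : ℂ) * Complex.I) / den (x + ((-(rr/2) : ℝ) : ℂ) * Complex.I))
    (F' := fun z (x:ℝ) => om * (2 * π * om * (x + ((-(rr/2) : ℝ) : ℂ) * Complex.I)) *
    nu z (x + ((-(rr/2) : ℝ) : ℂ) * Complex.I) / den (x + ((-(rr/2) : ℝ) : ℂ) * Complex.I))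
    (bound := fun x : ℝ => ‖om * (2 * π * om)‖ * 2 * K * Real.exp (-|x|/2))
    (Metric.ball_mem_nhds z one_pos) ?_ (MM_int _ abs_m z) ?_ ?_ ?_ ?_).2
  · exact Filter.Eventually.of_forall fun z => (MM_int _ abs_m z).aestronglyMeasurable
  · apply Continuous.aestronglyMeasurable
    refine Continuous.div ?_ (den_diff.continuous.comp hcont) hne
    exact (continuous_const.mul (continuous_const.mul hcont)).mul ((nu_diff z).continuous.comp hcont)
  · refine Filter.Eventually.of_forall fun x z' hz' => ?_
    have hz : ‖z'‖ ≤ ‖z‖ + 1 := by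
      rw [mem_ball_iff_norm] at hz'
      have := norm_le_norm_add_norm_sub z z'
      rw [norm_sub_rev] at this
      linarith
    have h1 := h x (-(rr/2)) (by rw [abs_m]; linarith [rr_lt]) z' hz
    have h2 := den_big' x
    rw [norm_div, div_le_iff₀ (by linarith)]
    rw [show om * (2 * π * om * (x + ((-(rr/2) : ℝ) : ℂ) * Complex.I)) = 
      (om * (2 * π * om)) * (x + ((-(rr/2) : ℝ) : ℂ) * Complex.I) by ring, norm_mul, norm_mul]
    set A := ‖om * (2 * π * om)‖
    have hA : 0 ≤ A := norm_nonneg _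
    have h3 : ‖(x + ((-(rr/2) : ℝ) : ℂ) * Complex.I)‖ * ‖nu z' (x + ((-(rr/2) : ℝ) : ℂ) * Complex.I)‖ ≤ K * Real.exp (-|x|/2) := by
      refine le_trans ?_ h1
      nlinarith [norm_nonneg (nu z' (x + ((-(rr/2) : ℝ) : ℂ) * Complex.I))]
    have h4 := mul_le_mul_of_nonneg_left h3 hA
    have h5 : 0 ≤ A * (K * Real.exp (-|x|/2)) := by positivity
    nlinarith
  · exact bnd_int.const_mul _
  · refine Filter.Eventually.of_forall fun x z' hz' => ?_
    unfold nu
    set w := (x + ((-(rr/2) : ℝ) : ℂ) * Complex.I)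
    have := ((((((hasDerivAt_id z').const_mul (2 * π : ℂ)).mul_const om).mul_const w).const_add
      (-(2 * π / 5) * w ^ 2)).cexp.const_mul om).div_const (den w)
    refine this.congr_deriv ?_
    simp only [id]
    ring

noncomputable def PP : ℂ := ∫ x : ℝ, Complex.I * x * Complex.exp (-(2 * π / 5) * x ^ 2) / den x

lemma PP_aux : (∫ x : ℝ, om * (2 * π * om * (x + ((-(rr/2) : ℝ) : ℂ) * Complex.I)) *
    nu 0 (x + ((-(rr/2) : ℝ) : ℂ) * Complex.I) / den (x + ((-(rr/2) : ℝ) : ℂ) * Complex.I)) = 2 * π * PP ∧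
    Integrable (fun x : ℝ => Complex.I * x * Complex.exp (-(2 * π / 5) * x ^ 2) / den x) := by
  have hpi : (π : ℂ) ≠ 0 := by exact_mod_cast Real.pi_ne_zero
  obtain ⟨K, hK, hb⟩ := nu_bound 0 le_rfl
  have := shift_gen (fun w => om * (2 * π * om * w) * nu 0 w) 
    ((by fun_prop : Differentiable ℂ fun w : ℂ => om * (2 * π * om * w)).mul (nu_diff 0)) (by simp)
    (‖om * (2 * π * om)‖ * K) (by
      intro x y hy
      rw [show om * (2 * π * om * (x + y * Complex.I)) = 
        (om * (2 * π * om)) * (x + y * Complex.I) by ring, norm_mul, norm_mul]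
      have h1 := mul_le_mul_of_nonneg_left (hb x y hy 0 (by simp)) (norm_nonneg (om * (2 * π * om)))
      have h2 : 0 ≤ ‖om * (2 * π * om)‖ * ‖nu 0 (x + y * Complex.I)‖ := by positivity
      linarith) (-(rr/2)) 0 abs_m.le (by simp; linarith [rr_pos])
  obtain ⟨h1, h2⟩ := this
  have e : ∀ x : ℝ, om * (2 * π * om * (x + ((0 : ℝ) : ℂ) * Complex.I)) * nu 0 (x + ((0 : ℝ) : ℂ) * Complex.I) /
      den (x + ((0 : ℝ) : ℂ) * Complex.I) =
      (2 * π) * (Complex.I * x * Complex.exp (-(2 * π / 5) * x ^ 2) / den x) := by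
    intro x
    simp only [nu, ← om_sq]
    simp
    ring
  simp only [e] at h1 h2
  rw [integral_const_mul] at h1
  refine ⟨h1, ?_⟩
  have := h2.const_mul (2 * π : ℂ)⁻¹
  simp_rw [inv_mul_cancel_left₀ (by simp [hpi] : (2 * π : ℂ) ≠ 0)] at this
  exact this

lemma M_deriv_zero : HasDerivAt M (2 * π * PP) 0 := by
  rw [← PP_aux.1]; exact M_deriv 0

noncomputable def ze : ℂ := Complex.exp (-(2 * π * Complex.I / 5))

lemma ze5 : ze ^ 5 = 1 := by
  rw [ze, ← Complex.exp_nat_mul, show ((5 : ℕ) : ℂ) * -(2 * π * Complex.I / 5) = -(2 * π * Complex.I) by push_cast; ring,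
    Complex.exp_neg, Complex.exp_two_pi_mul_I, inv_one]

lemma E_eq (z : ℂ) (j : ℕ) : Complex.exp (2 * π * Complex.I * (z - 2 / 5 * j - 1 / 5)) =
    Complex.exp (2 * π * Complex.I * z) * ze ^ (2 * j + 1) := by
  rw [ze, ← Complex.exp_nat_mul, ← Complex.exp_add]
  congr 1; push_cast; ring

noncomputable def GG : ℂ := om * (√(5/2) : ℝ)

lemma key0 (z : ℂ) : (1 - Complex.exp (10 * π * Complex.I * z)) * M z =
    (M 0 - MM (rr/2) 0) * (1 + ze * Complex.exp (2 * π * Complex.I * z) +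
      ze ^ 4 * Complex.exp (4 * π * Complex.I * z) + ze ^ 4 * Complex.exp (6 * π * Complex.I * z)
      + ze * Complex.exp (8 * π * Complex.I * z)) - 
    GG * (Complex.exp (5 * π * Complex.I / 2 * z ^ 2) + 
      Complex.I * (Complex.exp (5 * π * Complex.I / 2 * z ^ 2) * Complex.exp (5 * π * Complex.I * z))) := by
  have f : ∀ j : ℕ, M (z - 2/5 * j) = (M 0 - MM (rr/2) 0) +
      Complex.exp (2 * π * Complex.I * z) * ze ^ (2 * j + 1) * M (z - 2/5 * (j + 1 : ℕ)) := by
    intro j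
    rw [func2, E_eq]
    congr 3
    push_cast; ring
  have f0 := f 0
  have f1 := f 1
  have f2 := f 2
  have f3 := f 3
  have f4 := f 4
  have g1 := func1 (z - 2)
  have g2 := func1 (z - 1)
  rw [← GG] at g1 g2
  rw [show z - 2 + 1 = z - 1 by ring] at g1
  rw [show z - 1 + 1 = z by ring] at g2
  norm_num at f0 f1 f2 f3 f4
  have p2 : Complex.exp (4 * π * Complex.I * z) = Complex.exp (2 * π * Complex.I * z) ^ 2 := by
    rw [← Complex.exp_nat_mul]; congr 1; push_cast; ring
  have p3 : Complex.exp (6 * π * Complex.I * z) = Complex.exp (2 * π * Complex.I * z) ^ 3 := by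
    rw [← Complex.exp_nat_mul]; congr 1; push_cast; ring
  have p4 : Complex.exp (8 * π * Complex.I * z) = Complex.exp (2 * π * Complex.I * z) ^ 4 := by
    rw [← Complex.exp_nat_mul]; congr 1; push_cast; ring
  have p5 : Complex.exp (10 * π * Complex.I * z) = Complex.exp (2 * π * Complex.I * z) ^ 5 := by
    rw [← Complex.exp_nat_mul]; congr 1; push_cast; ring
  have q2 : Complex.exp (10 * π * Complex.I * z) * Complex.exp (5 * π * Complex.I / 2 * (z - 2) ^ 2) =
      Complex.exp (5 * π * Complex.I / 2 * z ^ 2) := by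
    rw [← Complex.exp_add, ← Complex.exp_periodic.int_mul 5 (5 * π * Complex.I / 2 * z ^ 2)]
    congr 1; push_cast; ring
  have q1 : Complex.exp (10 * π * Complex.I * z) * Complex.exp (5 * π * Complex.I / 2 * (z - 1) ^ 2) =
      Complex.I * (Complex.exp (5 * π * Complex.I / 2 * z ^ 2) * Complex.exp (5 * π * Complex.I * z)) := by
    have : Complex.I = Complex.exp (π / 2 * Complex.I + (1 : ℤ) * (2 * π * Complex.I)) := by
      rw [Complex.exp_periodic.int_mul 1, Complex.exp_pi_div_two_mul_I]
    conv_rhs => enter [1]; rw [this]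
    rw [← Complex.exp_add, ← Complex.exp_add, ← Complex.exp_add]
    congr 1; push_cast; ring
  rw [← q1, ← q2, p2, p3, p4, p5]
  set e := Complex.exp (2 * π * Complex.I * z)
  set k := M 0 - MM (rr/2) 0
  have z9 : ze ^ 9 = ze ^ 4 := by linear_combination ze ^ 4 * ze5
  have z16 : ze ^ 16 = ze := by linear_combination (ze ^ 11 + ze ^ 6 + ze) * ze5
  have z25 : ze ^ 25 = 1 := by linear_combination (ze ^ 20 + ze ^ 15 + ze ^ 10 + ze ^ 5 + 1) * ze5
  have tot : M z = k * (1 + e * ze + e ^ 2 * ze ^ 4 + e ^ 3 * ze ^ 9 + e ^ 4 * ze ^ 16) + e ^ 5 * ze ^ 25 * M (z - 2) := by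
    linear_combination f0 + e * ze * f1 + e ^ 2 * ze ^ 4 * f2 + e ^ 3 * ze ^ 9 * f3 + e ^ 4 * ze ^ 16 * f4
  rw [z9, z16, z25] at tot
  linear_combination tot - e ^ 5 * (g1 + g2)

lemma GG_eq : GG = ((√5 / 2 : ℝ) : ℂ) * (1 + Complex.I) := by
  have h : rr * √(5/2) = √5 / 2 := by
    unfold rr
    rw [div_mul_eq_mul_div, ← Real.sqrt_mul (by norm_num)]; norm_num
  rw [← h, GG, om_eq]; push_cast; ring

lemma cos_val : Real.cos (2 * π / 5) = (√5 - 1) / 4 := by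
  rw [show 2 * π / 5 = 2 * (π / 5) by ring, Real.cos_two_mul, Real.cos_pi_div_five]
  have : √5 ^ 2 = 5 := Real.sq_sqrt (by norm_num)
  linear_combination this / 8

lemma ze_eq : ze = (((√5 - 1) / 4 : ℝ) : ℂ) - (Real.sin (2 * π / 5) : ℝ) * Complex.I := by
  rw [ze, show -(2 * π * Complex.I / 5) = ((-(2 * π / 5) : ℝ) : ℂ) * Complex.I by push_cast; ring,
    Complex.exp_mul_I, ← Complex.ofReal_cos, ← Complex.ofReal_sin, Real.cos_neg, Real.sin_neg, cos_val]
  push_cast; ring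

lemma ze4_eq : ze ^ 4 = (((√5 - 1) / 4 : ℝ) : ℂ) + (Real.sin (2 * π / 5) : ℝ) * Complex.I := by
  have : ze ^ 4 = Complex.exp (((2 * π / 5 : ℝ) : ℂ) * Complex.I) := by
    rw [ze, ← Complex.exp_nat_mul, ← Complex.exp_periodic]
    congr 1; push_cast; ring
  rw [this,
    Complex.exp_mul_I, ← Complex.ofReal_cos, ← Complex.ofReal_sin, cos_val]

lemma kappa : M 0 - MM (rr/2) 0 = Complex.I := by
  have h := key0 0
  simp only [mul_zero, Complex.exp_zero, sub_self, zero_mul, zero_pow two_ne_zero, mul_one] at h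
  rw [GG_eq, ze4_eq, ze_eq] at h
  have h5 : ((√5 : ℝ) : ℂ) ≠ 0 := by
    exact_mod_cast (Real.sqrt_pos.mpr (by norm_num : (0:ℝ) < 5)).ne'
  apply mul_right_cancel₀ h5
  push_cast at h
  linear_combination -h + ((√5 : ℝ) / 2 : ℂ) * Complex.I_sq

lemma hexp (c z : ℂ) : HasDerivAt (fun z => Complex.exp (c * z)) (c * Complex.exp (c * z)) z := by
  have := ((hasDerivAt_id z).const_mul c).cexp
  simp only [id, mul_one] at this
  rwa [mul_comm] at this

lemma hexp2 (c z : ℂ) : HasDerivAt (fun z => Complex.exp (c * z ^ 2)) (2 * c * (z * Complex.exp (c * z ^ 2))) z := by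
  have := ((hasDerivAt_pow 2 z).const_mul c).cexp
  refine this.congr_deriv ?_
  push_cast; ring

lemma final : (PP).re = (8 - 3 * √5) / 16 := by
  have hM : Differentiable ℂ M := fun z => (M_deriv z).differentiableAt
  have hM' : Differentiable ℂ (deriv M) := by
    rw [← differentiableOn_univ]
    exact (hM.differentiableOn).deriv isOpen_univ
  have m0 : deriv M 0 = 2 * π * PP := M_deriv_zero.deriv
  have key := key0
  rw [kappa] at key
  have d1 : ∀ z, _ := fun z => ((hexp (10 * π * Complex.I) z).const_sub 1).mul (hM z).hasDerivAt
  have n1 : ∀ z, _ := fun z => ((((((hexp (2 * π * Complex.I) z).const_mul ze).const_add 1).add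
    ((hexp (4 * π * Complex.I) z).const_mul (ze^4))).add
    ((hexp (6 * π * Complex.I) z).const_mul (ze^4))).add
    ((hexp (8 * π * Complex.I) z).const_mul ze)).const_mul Complex.I |>.sub
    (((hexp2 (5 * π * Complex.I / 2) z).add (((hexp2 (5 * π * Complex.I / 2) z).mul
      (hexp (5 * π * Complex.I) z)).const_mul Complex.I)).const_mul GG)
  have key1 := fun z => (d1 z).unique ((n1 z).congr_of_eventuallyEq (Filter.Eventually.of_forall key))
  have d2 := ((((hexp (10 * π * Complex.I) 0).const_mul (10 * π * Complex.I)).neg).mul (hM 0).hasDerivAt).add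
    (((hexp (10 * π * Complex.I) 0).const_sub 1).mul (hM' 0).hasDerivAt)
  have n2 := (((((((hexp (2 * π * Complex.I) 0).const_mul (2 * π * Complex.I)).const_mul ze)).add
    (((hexp (4 * π * Complex.I) 0).const_mul (4 * π * Complex.I)).const_mul (ze^4))).add
    (((hexp (6 * π * Complex.I) 0).const_mul (6 * π * Complex.I)).const_mul (ze^4))).add
    (((hexp (8 * π * Complex.I) 0).const_mul (8 * π * Complex.I)).const_mul ze)).const_mul Complex.I |>.sub
    (((((hasDerivAt_id (0:ℂ)).mul (hexp2 (5 * π * Complex.I / 2) 0)).const_mul (2 * (5 * π * Complex.I / 2))).add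
      (((((((hasDerivAt_id (0:ℂ)).mul (hexp2 (5 * π * Complex.I / 2) 0)).const_mul
        (2 * (5 * π * Complex.I / 2)))).mul (hexp (5 * π * Complex.I) 0)).add
        ((hexp2 (5 * π * Complex.I / 2) 0).mul ((hexp (5 * π * Complex.I) 0).const_mul
          (5 * π * Complex.I)))).const_mul Complex.I)).const_mul GG)
  have key2 := d2.unique (n2.congr_of_eventuallyEq (Filter.Eventually.of_forall key1))
  have k1 := key1 0
  simp at k1 key2
  rw [m0] at key2
  have hpi : (π : ℂ) ≠ 0 := by exact_mod_cast Real.pi_ne_zero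
  have hI := Complex.I_sq
  have hP : (-40 * π ^ 2 * Complex.I) * PP = (-40 * π ^ 2 * Complex.I) * (-(80 * (((√5 - 1) / 4 : ℝ) : ℂ) + 16 * Complex.I * (Real.sin (2 * π / 5) : ℝ) - 25 * GG) / 40
     + Complex.I * ((√5 / (8 * π) : ℝ) : ℂ)) := by
    have e : (π ^ 2 : ℂ) * ((√5 / (8 * π) : ℝ) : ℂ) = π * (√5 : ℝ) / 8 := by push_cast; field_simp
    have hG : GG = ((√5 : ℝ) : ℂ) / 2 * (1 + Complex.I) := by rw [GG_eq]; push_cast; ring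
    have z1 := ze_eq
    have z4 := ze4_eq
    generalize (((√5 - 1) / 4 : ℝ) : ℂ) = k at *
    generalize ((Real.sin (2 * π / 5) : ℝ) : ℂ) = s at *
    linear_combination key2 - 10 * π * Complex.I * k1 + 40 * Complex.I ^ 2 * e - 32 * π ^ 2 * Complex.I ^ 3 * z1
      - 48 * π ^ 2 * Complex.I ^ 3 * z4 - 5 * π * Complex.I * (1 + Complex.I) * hG
      + (-π ^ 2 * Complex.I * (80 * k + 16 * Complex.I * s - 25 * GG) - 5 * π / 2 * ((√5 : ℝ) : ℂ) * Complex.I) * hI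
  have hP' := mul_left_cancel₀ (by simp [hpi]) hP
  have hQ : PP = ((-2 * ((√5 - 1) / 4) + 5 * √5 / 16 : ℝ) : ℂ) +
      ((-(2 / 5) * Real.sin (2 * π / 5) + 5 * √5 / 16 + √5 / (8 * π) : ℝ) : ℂ) * Complex.I := by
    rw [hP', GG_eq]; push_cast; ring
  rw [hQ, Complex.add_re, Complex.ofReal_re, Complex.re_ofReal_mul, Complex.I_re]
  ring

lemma subst_exp (g : ℝ → ℂ) : ∫ u : ℝ, (Real.exp u : ℂ) * g (Real.exp u) = ∫ y in Set.Ioi (0:ℝ), g y := by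
  have h := integral_image_eq_integral_abs_deriv_smul (s := Set.univ) (f := Real.exp) (f' := Real.exp)
    MeasurableSet.univ (fun x _ => (Real.hasDerivAt_exp x).hasDerivWithinAt)
    (Real.exp_injective.injOn) g
  rw [Set.image_univ, Real.range_exp] at h
  rw [h]
  simp [abs_of_pos (Real.exp_pos _)]

noncomputable def HH (u : ℂ) : ℂ := Complex.exp u * Complex.exp (Complex.I * (2 * π / 5) * Complex.exp u) /
  (Complex.exp (2 * π * Complex.exp (u / 2)) - 1)

lemma HH_re (x y : ℝ) (hy0 : 0 ≤ y) (hy : y ≤ π / 2) :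
    4 * Real.exp (x / 2) ≤ (2 * π * Complex.exp ((x + y * Complex.I) / 2)).re := by
  have h1 : (2 * π * Complex.exp ((x + y * Complex.I) / 2)).re = 2 * π * (Real.exp (x / 2) * Real.cos (y / 2)) := by
    have : (2 * π : ℂ) = ((2 * π : ℝ) : ℂ) := by push_cast; rfl
    rw [this, Complex.re_ofReal_mul, Complex.exp_re]
    simp
  rw [h1]
  have h2 : Real.cos (π / 4) ≤ Real.cos (y / 2) :=
    Real.cos_le_cos_of_nonneg_of_le_pi (by linarith) (by linarith [Real.pi_gt_three]) (by linarith)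
  rw [Real.cos_pi_div_four] at h2
  have h3 : (0.7:ℝ) < √2 / 2 := by
    have : (1.4 : ℝ) < √2 := by
      apply Real.lt_sqrt_of_sq_lt; norm_num
    linarith
  have h4 : 4 ≤ 2 * π * Real.cos (y / 2) := by nlinarith [Real.pi_gt_three]
  have := mul_le_mul_of_nonneg_right h4 (Real.exp_pos (x/2)).le
  linarith

lemma HH_den (x y : ℝ) (hy0 : 0 ≤ y) (hy : y ≤ π / 2) :
    Real.exp (4 * Real.exp (x / 2)) - 1 ≤ ‖Complex.exp (2 * π * Complex.exp ((x + y * Complex.I) / 2)) - 1‖ := by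
  have h1 := norm_sub_norm_le (Complex.exp (2 * π * Complex.exp ((x + y * Complex.I) / 2))) 1
  rw [Complex.norm_exp, norm_one] at h1
  have h2 := Real.exp_le_exp.mpr (HH_re x y hy0 hy)
  linarith

lemma HH_den_pos (x : ℝ) : 0 < Real.exp (4 * Real.exp (x / 2)) - 1 := by
  have := Real.add_one_lt_exp (x := 4 * Real.exp (x/2)) (by positivity)
  have := Real.exp_pos (x/2)
  linarith

lemma HH_diff (w : ℂ) (hy0 : 0 ≤ w.im) (hy : w.im ≤ π / 2) : DifferentiableAt ℂ HH w := by
  have h := lt_of_lt_of_le (HH_den_pos w.re) (HH_den w.re w.im hy0 hy)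
  rw [Complex.re_add_im] at h
  have h' := norm_pos_iff.mp h
  unfold HH
  exact DifferentiableAt.div (by fun_prop) (by fun_prop) h'

lemma HH_bound (x y : ℝ) (hy0 : 0 ≤ y) (hy : y ≤ π / 2) :
    ‖HH (x + y * Complex.I)‖ ≤ 1 * Real.exp (-|x|/2) := by
  have hd := HH_den x y hy0 hy
  have hp := HH_den_pos x
  have hn : ‖Complex.exp (x + y * Complex.I) * Complex.exp (Complex.I * (2 * π / 5) * Complex.exp (x + y * Complex.I))‖ ≤
      Real.exp x := by
    rw [norm_mul, Complex.norm_exp, Complex.norm_exp]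
    have : (Complex.I * (2 * π / 5) * Complex.exp (x + y * Complex.I)).re = -(2 * π / 5 * (Real.exp x * Real.sin y)) := by
      have e : Complex.I * (2 * π / 5) * Complex.exp (x + y * Complex.I) = ((2 * π / 5 : ℝ) : ℂ) * (Complex.I * Complex.exp (x + y * Complex.I)) := by
        push_cast; ring
      rw [e, Complex.re_ofReal_mul, Complex.I_mul_re, Complex.exp_im]
      simp
    rw [this]
    have hs : 0 ≤ Real.sin y := Real.sin_nonneg_of_nonneg_of_le_pi hy0 (by linarith [Real.pi_gt_three])
    have h1 : Real.exp (-(2 * π / 5 * (Real.exp x * Real.sin y))) ≤ 1 := by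
      rw [Real.exp_le_one_iff]
      have : 0 ≤ 2 * π / 5 * (Real.exp x * Real.sin y) := by positivity
      linarith
    simp only [Complex.add_re, Complex.ofReal_re, Complex.re_ofReal_mul, Complex.I_re, mul_zero, add_zero]
    exact mul_le_of_le_one_right (Real.exp_pos x).le h1
  unfold HH
  rw [norm_div, one_mul, div_le_iff₀ (by linarith)]
  refine le_trans hn ?_
  refine le_trans ?_ (mul_le_mul_of_nonneg_left hd (Real.exp_pos _).le)
  set t := Real.exp (x / 2) with ht
  have tp : 0 < t := Real.exp_pos _
  have hx : Real.exp x = t ^ 2 := by rw [ht, ← Real.exp_nat_mul]; congr 1; push_cast; ring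
  rw [hx]
  rcases le_total x 0 with h | h
  · have : Real.exp (-|x|/2) = t := by rw [abs_of_nonpos h, ht]; congr 1; ring
    rw [this]
    nlinarith [Real.add_one_le_exp (4 * t)]
  · have h1 : Real.exp (-|x|/2) * t = 1 := by
      rw [abs_of_nonneg h, ht, ← Real.exp_add, ← Real.exp_zero]; congr 1; ring
    have h2 : 1 + t ^ 3 ≤ Real.exp (4 * t) := by
      have a1 := Real.quadratic_le_exp_of_nonneg (x := 2 * t) (by positivity)
      have a2 : Real.exp (4 * t) = Real.exp (2 * t) ^ 2 := by
        rw [← Real.exp_nat_mul]; congr 1; push_cast; ring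
      rw [a2]
      have a3 : (1 + 2 * t + 2 * t ^ 2) ^ 2 ≤ Real.exp (2 * t) ^ 2 := by
        apply pow_le_pow_left₀ (by positivity)
        linarith
      have : 0 ≤ t ^ 3 ∧ 0 ≤ t ^ 4 ∧ 0 ≤ t ^ 2 := ⟨by positivity, by positivity, by positivity⟩
      nlinarith
    have h3 : t ^ 2 = Real.exp (-|x|/2) * t ^ 3 := by linear_combination (-t^2) * h1
    rw [h3]
    exact mul_le_mul_of_nonneg_left (by linarith) (Real.exp_pos _).le

lemma HH_shift : ∫ x : ℝ, HH (x + ((0:ℝ):ℂ) * Complex.I) = ∫ x : ℝ, HH (x + ((π/2:ℝ):ℂ) * Complex.I) := by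
  have hp : (0:ℝ) ≤ π / 2 := by positivity
  apply strip_shift HH 0 (π/2) 1 0
  · intro w hw
    rw [Set.uIcc_of_le hp] at hw
    exact HH_diff w hw.1 hw.2
  · intro x y _ hw
    rw [Set.uIcc_of_le hp] at hw
    exact HH_bound x y hw.1 hw.2

lemma HH_int0 : Integrable (fun x : ℝ => HH (x + ((0:ℝ):ℂ) * Complex.I)) := by
  have hp : (0:ℝ) ≤ π / 2 := by positivity
  apply line_int HH 0 1 0
  · intro w hw
    exact (HH_diff w hw.ge (by rw [hw]; exact hp)).continuousAt
  · intro x _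
    exact HH_bound x 0 le_rfl hp

lemma HH_zero (x : ℝ) : HH (x + ((0:ℝ):ℂ) * Complex.I) = (Real.exp x : ℂ) * 
    (fun y : ℝ => Complex.exp (((2 * π * y / 5 : ℝ) : ℂ) * Complex.I) / ((Real.exp (2 * π * Real.sqrt y) - 1 : ℝ) : ℂ)) (Real.exp x) := by
  have h : Real.sqrt (Real.exp x) = Real.exp (x / 2) := by
    rw [← Real.exp_half]
  simp only [h]
  unfold HH
  push_cast
  rw [zero_mul, add_zero, mul_div_assoc]
  congr 3
  ring

lemma target_eq : ∫ x in Set.Ioi (0:ℝ), Real.cos (2 * π * x / 5) / (Real.exp (2 * π * Real.sqrt x) - 1) =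
    (∫ x : ℝ, HH (x + ((0:ℝ):ℂ) * Complex.I)).re := by
  have h1 := subst_exp (fun y => ((Real.cos (2 * π * y / 5) / (Real.exp (2 * π * Real.sqrt y) - 1) : ℝ) : ℂ))
  rw [integral_complex_ofReal] at h1
  have h2 : ∀ x : ℝ, (HH (x + ((0:ℝ):ℂ) * Complex.I)).re = 
      Real.exp x * (Real.cos (2 * π * Real.exp x / 5) / (Real.exp (2 * π * Real.sqrt (Real.exp x)) - 1)) := by
    intro x
    rw [HH_zero, Complex.re_ofReal_mul, Complex.div_ofReal_re, Complex.exp_ofReal_mul_I_re]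
  have h3 := integral_re HH_int0
  have h4 : (∫ x : ℝ, HH (x + ((0:ℝ):ℂ) * Complex.I)).re = ∫ x : ℝ, (HH (x + ((0:ℝ):ℂ) * Complex.I)).re := h3.symm
  rw [h4]
  simp only [h2]
  apply Complex.ofReal_injective
  rw [← h1, ← integral_complex_ofReal]
  push_cast
  rfl

noncomputable def ph (x : ℝ) : ℂ := Complex.I * x * Complex.exp (-(2 * π / 5) * x ^ 2) / den x

lemma exp_om : Complex.exp (((π / 4 : ℝ) : ℂ) * Complex.I) = om := by
  apply Complex.ext
  · rw [Complex.exp_ofReal_mul_I_re, Real.cos_pi_div_four]; rfl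
  · rw [Complex.exp_ofReal_mul_I_im, Real.sin_pi_div_four]; rfl

lemma HH_top (x : ℝ) : HH (x + ((π/2:ℝ):ℂ) * Complex.I) =
    (fun v : ℝ => (Real.exp v : ℂ) * ph (Real.exp v)) (x / 2) := by
  have e1 : Complex.exp (x + ((π/2:ℝ):ℂ) * Complex.I) = Complex.I * Complex.exp (x / 2) ^ 2 := by
    rw [Complex.exp_add, ← Complex.exp_nat_mul]
    have : Complex.exp (((π/2:ℝ):ℂ) * Complex.I) = Complex.I := by
      push_cast; exact Complex.exp_pi_div_two_mul_I
    rw [this, mul_comm]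
    congr 2; push_cast; ring
  have e2 : Complex.exp ((x + ((π/2:ℝ):ℂ) * Complex.I) / 2) = om * Complex.exp (x / 2) := by
    rw [← exp_om, ← Complex.exp_add]; congr 1; push_cast; ring
  unfold HH ph den
  rw [e1, e2]
  push_cast
  have e3 : Complex.I * (2 * π / 5) * (Complex.I * Complex.exp (x / 2) ^ 2) = -(2 * π / 5) * Complex.exp (x / 2) ^ 2 := by
    linear_combination (2 * π / 5) * Complex.exp (x / 2) ^ 2 * Complex.I_sq
  have e4 : 2 * π * (om * Complex.exp (x / 2)) = 2 * π * om * Complex.exp (x / 2) := by ring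
  rw [e3, e4]
  ring

lemma top_eq : ∫ x : ℝ, HH (x + ((π/2:ℝ):ℂ) * Complex.I) = 2 * ∫ x in Set.Ioi (0:ℝ), ph x := by
  simp only [HH_top]
  rw [Measure.integral_comp_div (fun v : ℝ => (Real.exp v : ℂ) * ph (Real.exp v)) 2, subst_exp]
  simp

lemma ph_neg (x : ℝ) (hx : 0 < x) : ph (-x) = ph x + Complex.I * ((x * Real.exp (-(2 * π / 5) * x ^ 2) : ℝ) : ℂ) := by
  have h1 := den_ne x (by simp; linarith [rr_pos]) (by exact_mod_cast hx.ne')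
  have h2 := den_ne ((-x : ℝ) : ℂ) (by simp; linarith [rr_pos]) (by exact_mod_cast (neg_ne_zero.mpr hx.ne'))
  unfold ph
  have h3 : den ((-x : ℝ) : ℂ) * (den x + 1) = - den x := by
    unfold den
    have : Complex.exp (2 * π * om * ((-x : ℝ) : ℂ)) * Complex.exp (2 * π * om * x) = 1 := by
      rw [← Complex.exp_add, ← Complex.exp_zero]; congr 1; push_cast; ring
    linear_combination this
  have e : Complex.exp (-(2 * π / 5) * ((-x : ℝ) : ℂ) ^ 2) = Complex.exp (-(2 * π / 5) * (x : ℂ) ^ 2) := by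
    congr 1; push_cast; ring
  rw [e]
  have e' : ((x * Real.exp (-(2 * π / 5) * x ^ 2) : ℝ) : ℂ) = x * Complex.exp (-(2 * π / 5) * (x : ℂ) ^ 2) := by
    push_cast; rfl
  rw [e']
  generalize Complex.exp (-(2 * π / 5) * (x : ℂ) ^ 2) = q
  generalize den ((-x : ℝ) : ℂ) = a at *
  generalize den (x : ℂ) = b at *
  push_cast
  field_simp
  linear_combination (-(x : ℂ) * q) * h3

lemma PP_re : PP.re = (2 * ∫ x in Set.Ioi (0:ℝ), ph x).re := by
  have hi : Integrable ph := PP_aux.2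
  have h0 : PP = ∫ x, ph x := rfl
  have h1 := intervalIntegral.integral_Iic_add_Ioi (b := (0:ℝ)) hi.integrableOn hi.integrableOn
  have h2 := integral_comp_neg_Ioi (0:ℝ) ph
  rw [neg_zero] at h2
  have hn : IntegrableOn (fun x => ph (-x)) (Set.Ioi 0) := hi.comp_neg.integrableOn
  have h3 : ∫ x in Set.Ioi (0:ℝ), (ph (-x) - ph x) = 
      ∫ x in Set.Ioi (0:ℝ), Complex.I * ((x * Real.exp (-(2 * π / 5) * x ^ 2) : ℝ) : ℂ) := by
    apply setIntegral_congr_fun measurableSet_Ioi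
    intro x hx
    simp only [ph_neg x hx]; ring
  rw [integral_sub hn hi.integrableOn, integral_const_mul, integral_complex_ofReal] at h3
  have h4 : PP = 2 * (∫ x in Set.Ioi (0:ℝ), ph x) + Complex.I * ((∫ x in Set.Ioi (0:ℝ), (x * Real.exp (-(2 * π / 5) * x ^ 2)) : ℝ) : ℂ) := by
    rw [← h3, h0, ← h1, h2]; ring
  rw [h4, Complex.add_re, Complex.I_mul_re, Complex.ofReal_im]; simp

theorem stmt16 :
    ∫ x in Set.Ioi (0:ℝ), Real.cos (2 * π * x / 5) / (Real.exp (2 * π * Real.sqrt x) - 1) = (8 - 3 * Real.sqrt 5) / 16 := by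
  rw [target_eq, HH_shift, top_eq, ← PP_re, final]
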